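/- Suppose r ≤ k < l. The forgetful map rConf(l, ℝ^n) → rConf(k, ℝ^n), dropping l − k configuration points, is ((r−1)n − 1)-connected. -/

import Mathlib

noncomputable section

open scoped Topology unitInterval

/-- The map induced by a continuous map on homotopy groups. -/
def inducedPi {X Y : Type*} [TopologicalSpace X] [TopologicalSpace Y] (n : ℕ)
    (f : C(X, Y)) (x : X) :
    HomotopyGroup (Fin n) X x → HomotopyGroup (Fin n) Y (f x) :=
  Quotient.map
    (fun p => ⟨f.comp p.1, fun y hy => by
      simp only [ContinuousMap.comp_apply]
      rw [p.2 y hy]⟩)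
    (fun p q h => h.map fun F => F.compContinuousMap f)

/-- A map is `c`-connected if it induces isomorphisms on homotopy groups in degrees
below `c` and a surjection in degree `c` (for every basepoint); for `c ≥ 0` we also
require that the domain is nonempty whenever the codomain is. -/
def IsConnectedMap {X Y : Type*} [TopologicalSpace X] [TopologicalSpace Y]
    (c : ℤ) (f : C(X, Y)) : Prop :=
  (0 ≤ c → Nonempty Y → Nonempty X) ∧
    (∀ (x : X) (i : ℕ), (i : ℤ) < c → Function.Bijective (inducedPi i f x)) ∧
    (∀ (x : X) (i : ℕ), (i : ℤ) = c → Function.Surjective (inducedPi i f x))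

/-- The homotopy fiber of `f : X → Y` over `y`: pairs of a point of `X` together with a
path from its image to `y`. -/
def HomotopyFiber {X Y : Type*} [TopologicalSpace X] [TopologicalSpace Y]
    (f : C(X, Y)) (y : Y) : Type _ :=
  {p : X × C(I, Y) // p.2 0 = f p.1 ∧ p.2 1 = y}

instance {X Y : Type*} [TopologicalSpace X] [TopologicalSpace Y] (f : C(X, Y)) (y : Y) :
    TopologicalSpace (HomotopyFiber f y) :=
  inferInstanceAs (TopologicalSpace {p : X × C(I, Y) // p.2 0 = f p.1 ∧ p.2 1 = y})

/-- A space is `c`-connected if it is nonempty and all its homotopy groups in degrees `≤ c`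
(at every basepoint) are trivial. -/
def IsConnectedSpace (c : ℤ) (A : Type*) [TopologicalSpace A] : Prop :=
  Nonempty A ∧ ∀ (a : A) (i : ℕ), (i : ℤ) ≤ c → Subsingleton (HomotopyGroup (Fin i) A a)

/-- A weak homotopy equivalence. -/
def IsWeakHomotopyEquiv {X Y : Type*} [TopologicalSpace X] [TopologicalSpace Y]
    (f : C(X, Y)) : Prop :=
  (Nonempty Y → Nonempty X) ∧ ∀ (x : X) (i : ℕ), Function.Bijective (inducedPi i f x)

/-- `rConf(k, ℝⁿ)`: `k`-tuples of points of `ℝⁿ` with no `r`-fold coincidence. -/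
def RConf (r k n : ℕ) : Type :=
  {x : Fin k → EuclideanSpace ℝ (Fin n) //
    ∀ g : Fin r → Fin k, Function.Injective g → ¬ ∀ i j, x (g i) = x (g j)}

instance (r k n : ℕ) : TopologicalSpace (RConf r k n) :=
  inferInstanceAs (TopologicalSpace
    {x : Fin k → EuclideanSpace ℝ (Fin n) //
      ∀ g : Fin r → Fin k, Function.Injective g → ¬ ∀ i j, x (g i) = x (g j)})

/-- The forgetful map `rConf(l, ℝⁿ) → rConf(k, ℝⁿ)` dropping the last `l - k`
configuration points. -/
def rConfForget (r n : ℕ) {k l : ℕ} (hkl : k ≤ l) : C(RConf r l n, RConf r k n) where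
  toFun x := ⟨fun i => x.1 (Fin.castLE hkl i), fun g hg hc =>
    x.2 (fun i => Fin.castLE hkl (g i)) ((Fin.castLE_injective hkl).comp hg)
      fun i j => hc i j⟩
  continuous_toFun := by
    apply Continuous.subtype_mk
    apply continuous_pi
    intro i
    exact (continuous_apply (Fin.castLE hkl i)).comp continuous_subtype_val


section helpers

variable {E : Type*} [NormedAddCommGroup E] [NormedSpace ℝ E]

/-- Build a generalized loop in a subtype from a vector-valued function. -/
def mkLoop {i : ℕ} {S : E → Prop} (x : {e // S e}) (u : (Fin i → I) → E) (hc : Continuous u)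
    (hS : ∀ y, S (u y)) (hb : ∀ y ∈ Cube.boundary (Fin i), u y = x.1) :
    GenLoop (Fin i) {e // S e} x :=
  ⟨⟨fun y => ⟨u y, hS y⟩, hc.subtype_mk hS⟩, fun y hy => Subtype.ext (hb y hy)⟩

theorem homotopic_of {i : ℕ} {S : E → Prop} {x : {e // S e}}
    (f g : GenLoop (Fin i) {e // S e} x) (H : I × (Fin i → I) → E) (hc : Continuous H)
    (hS : ∀ p, S (H p)) (h0 : ∀ y, H (0, y) = (f.1 y).1) (h1 : ∀ y, H (1, y) = (g.1 y).1)
    (hb : ∀ t, ∀ y ∈ Cube.boundary (Fin i), H (t, y) = x.1) : GenLoop.Homotopic f g := by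
  refine ⟨⟨⟨⟨fun p => ⟨H p, hS p⟩, hc.subtype_mk hS⟩, fun y => Subtype.ext (h0 y),
    fun y => Subtype.ext (h1 y)⟩, fun t y hy => ?_⟩⟩
  apply Subtype.ext
  have h2 : (f.1 y) = x := f.2 y hy
  show H (t, y) = (f.1 y).1
  rw [h2]
  exact hb t y hy

/-- Expansion of the cube about its center, clamped to the cube. -/
def cubeExp {i : ℕ} (t : I) (y : Fin i → I) : Fin i → I :=
  fun j => Set.projIcc (0 : ℝ) 1 zero_le_one ((y j : ℝ) + t * ((y j : ℝ) - 1 / 2))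

theorem cubeExp_zero {i : ℕ} (y : Fin i → I) : cubeExp 0 y = y := by
  funext j
  simp [cubeExp]

theorem cubeExp_continuous {i : ℕ} : Continuous fun p : I × (Fin i → I) => cubeExp p.1 p.2 := by
  unfold cubeExp
  refine continuous_pi fun j => continuous_projIcc.comp ?_
  fun_prop

theorem cubeExp_boundary {i : ℕ} (t : I) (y : Fin i → I) (hy : y ∈ Cube.boundary (Fin i)) :
    cubeExp t y ∈ Cube.boundary (Fin i) := by
  obtain ⟨j, hj⟩ := hy
  refine ⟨j, ?_⟩
  have ht := t.2.1
  rcases hj with hj | hj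
  · left
    apply Set.projIcc_of_le_left
    rw [hj]; simp [ht]
  · right
    apply Set.projIcc_of_right_le
    rw [hj]; simp; nlinarith

/-- A cutoff function on the cube. -/
def bb {i : ℕ} (y : Fin i → I) : ℝ := ∏ j, (min 1 (4 * (y j : ℝ)) * min 1 (4 * (1 - (y j : ℝ))))

theorem bb_continuous {i : ℕ} : Continuous (bb (i := i)) := by
  unfold bb
  fun_prop

theorem bb_nonneg {i : ℕ} (y : Fin i → I) : 0 ≤ bb y := by
  refine Finset.prod_nonneg fun j _ => mul_nonneg ?_ ?_
  · exact le_min zero_le_one (by linarith [(y j).2.1])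
  · exact le_min zero_le_one (by linarith [(y j).2.2])

theorem bb_le_one {i : ℕ} (y : Fin i → I) : bb y ≤ 1 := by
  refine Finset.prod_le_one (fun j _ => mul_nonneg ?_ ?_) fun j _ => mul_le_one₀ ?_ ?_ ?_
  · exact le_min zero_le_one (by linarith [(y j).2.1])
  · exact le_min zero_le_one (by linarith [(y j).2.2])
  · exact min_le_left _ _
  · exact le_min zero_le_one (by linarith [(y j).2.2])
  · exact min_le_left _ _

theorem bb_boundary {i : ℕ} (y : Fin i → I) (hy : y ∈ Cube.boundary (Fin i)) : bb y = 0 := by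
  obtain ⟨j, hj⟩ := hy
  refine Finset.prod_eq_zero (Finset.mem_univ j) ?_
  rcases hj with hj | hj <;> rw [hj] <;> simp

theorem bb_or {i : ℕ} (y : Fin i → I) : bb y = 1 ∨ cubeExp 1 y ∈ Cube.boundary (Fin i) := by
  by_cases h : ∀ j, 1 / 4 ≤ (y j : ℝ) ∧ (y j : ℝ) ≤ 3 / 4
  · left
    refine Finset.prod_eq_one fun j _ => ?_
    rw [min_eq_left (by linarith [(h j).1]), min_eq_left (by linarith [(h j).2]), one_mul]
  · right
    push Not at h
    obtain ⟨j, hj⟩ := h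
    refine ⟨j, ?_⟩
    by_cases h1 : 1 / 4 ≤ (y j : ℝ)
    · right
      apply Set.projIcc_of_right_le
      have := hj h1
      simp only [Set.Icc.coe_one]; linarith
    · left
      apply Set.projIcc_of_le_left
      simp only [Set.Icc.coe_one]; linarith

theorem exists_generic [FiniteDimensional ℝ E] {ι : Type*} [Finite ι] {i : ℕ}
    (V : ι → Submodule ℝ E) (hV : ∀ a, Module.finrank ℝ (V a) + i + 1 < Module.finrank ℝ E)
    (hE : 0 < Module.finrank ℝ E)
    (g : Bool → (Fin i → ℝ) → E) (hg : ∀ b, ContDiff ℝ 1 (g b)) :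
    ∃ p : E, ∀ a b y, (∀ t : ℝ, 0 ≤ t → t ≤ 1 → g b y ∉ V a →
      (1 - t) • g b y + t • p ∉ V a) := by
  let B : ι × Bool → Set E := fun a =>
    Set.range fun q : V a.1 × ℝ × (Fin i → ℝ) => (q.1 : E) - q.2.1 • g a.2 q.2.2
  have hB : ∀ a, dimH (B a) ≤ ((Module.finrank ℝ E - 1 : ℕ) : ENNReal) := by
    intro a
    have h0 := hg a.2
    have h1 : ContDiff ℝ 1 fun q : V a.1 × ℝ × (Fin i → ℝ) => (q.1 : E) - q.2.1 • g a.2 q.2.2 := by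
      have : ContDiff ℝ 1 fun q : V a.1 × ℝ × (Fin i → ℝ) => (q.1 : E) :=
        (V a.1).subtypeL.contDiff.comp contDiff_fst
      fun_prop
    refine h1.dimH_range_le.trans ?_
    have h2 : Module.finrank ℝ (V a.1 × ℝ × (Fin i → ℝ)) = Module.finrank ℝ (V a.1) + (1 + i) := by
      simp
    rw [h2]
    have := hV a.1
    exact_mod_cast (by omega)
  have hU : dimH (⋃ a, B a) < Module.finrank ℝ E := by
    rw [dimH_iUnion]
    refine (iSup_le hB).trans_lt ?_
    exact_mod_cast (by omega)
  obtain ⟨p, hp⟩ := (dense_compl_of_dimH_lt_finrank hU).nonempty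
  refine ⟨p, fun a b y t ht0 ht1 hgy hmem => ?_⟩
  rcases ht0.eq_or_lt with h | h
  · subst h; simp at hmem; exact hgy hmem
  · apply hp
    refine Set.mem_iUnion.2 ⟨(a, b), ⟨t⁻¹ • ⟨_, hmem⟩, t⁻¹ * (1 - t), y⟩, ?_⟩
    simp only [Submodule.coe_smul, smul_add, smul_smul]
    rw [inv_mul_cancel₀ h.ne']
    simp

theorem pi_trivial [FiniteDimensional ℝ E] {ι : Type*} [Finite ι] {i : ℕ}
    (V : ι → Submodule ℝ E) (hV : ∀ a, Module.finrank ℝ (V a) + i + 1 < Module.finrank ℝ E)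
    (hE : 0 < Module.finrank ℝ E)
    (S : E → Prop) (hS : ∀ e, S e ↔ ∀ a, e ∉ V a) (x : {e // S e})
    (f : GenLoop (Fin i) {e // S e} x) : GenLoop.Homotopic f GenLoop.const := by
  have hSo : IsOpen {e | S e} := by
    have : {e | S e} = ⋂ a, ((V a : Set E))ᶜ := by ext e; simp [hS]
    rw [this]
    exact isOpen_iInter_of_finite fun a => (Submodule.closed_of_finiteDimensional (V a)).isOpen_compl
  -- the vector valued loop
  let F : (Fin i → I) → E := fun y => (f.1 y).1
  have hF : Continuous F := continuous_subtype_val.comp f.1.continuous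
  have hFb : ∀ y ∈ Cube.boundary (Fin i), F y = x.1 := fun y hy => by
    show (f.1 y).1 = x.1
    rw [show f.1 y = x from f.2 y hy]
  obtain ⟨δ, hδ, hK⟩ := (isCompact_range hF).exists_thickening_subset_open hSo
    (by rintro _ ⟨y, rfl⟩; exact (f.1 y).2)
  have hnear : ∀ y e, dist e (F y) < δ → S e := fun y e he =>
    hK (Metric.mem_thickening_iff.2 ⟨F y, ⟨y, rfl⟩, he⟩)
  -- smooth approximation
  let G : (Fin i → ℝ) → E := fun z => F (cubeExp 1 fun j => Set.projIcc (0 : ℝ) 1 zero_le_one (z j))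
  have hG : Continuous G := by
    refine hF.comp (cubeExp_continuous.comp (Continuous.prodMk continuous_const ?_))
    exact continuous_pi fun j => (continuous_projIcc (h := zero_le_one)).comp (continuous_apply j)
  obtain ⟨g₀, hg₀, hg₀d, -⟩ := hG.exists_contDiff_approx 1 (ε := fun _ => δ / 4)
    continuous_const (fun _ => by positivity)
  let χ : ContDiffBump x.1 := ⟨δ / 4, δ / 2, by positivity, by linarith⟩
  let g : (Fin i → ℝ) → E := fun z => x.1 + (1 - χ (g₀ z)) • (g₀ z - x.1)
  have hg : ContDiff ℝ 1 g := by
    have h1 : ContDiff ℝ 1 χ := χ.contDiff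
    have h0 : ContDiff ℝ 1 g₀ := by simpa using hg₀
    have h2 : ContDiff ℝ 1 fun z => χ (g₀ z) := h1.comp h0
    fun_prop
  have hgd : ∀ z, dist (g z) (G z) < δ := by
    intro z
    have h1 : dist (g z) (g₀ z) ≤ δ / 2 := by
      have : g z - g₀ z = - (χ (g₀ z) • (g₀ z - x.1)) := by
        simp only [g]; module
      rw [dist_eq_norm, this, norm_neg, norm_smul, Real.norm_of_nonneg χ.nonneg]
      by_cases hc : dist (g₀ z) x.1 < δ / 2
      · rw [dist_eq_norm] at hc
        nlinarith [χ.le_one (x := g₀ z), χ.nonneg (x := g₀ z), norm_nonneg (g₀ z - x.1)]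
      · rw [χ.zero_of_le_dist (not_lt.1 hc)]; simp; positivity
    have h2 := hg₀d z
    have h3 := dist_triangle (g z) (g₀ z) (G z)
    linarith
  have hgx : ∀ z, G z = x.1 → g z = x.1 := by
    intro z hz
    have h2 := hg₀d z
    rw [hz] at h2
    simp only [g]
    rw [χ.one_of_mem_closedBall (by rw [Metric.mem_closedBall]; exact h2.le)]
    simp
  obtain ⟨p, hp⟩ := exists_generic V hV hE (fun b => if b then g else fun _ => x.1)
    (fun b => by cases b <;> simp [hg, contDiff_const])
  let co : (Fin i → I) → (Fin i → ℝ) := fun y j => (y j : ℝ)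
  have hco : Continuous co := by fun_prop
  have hGco : ∀ y, G (co y) = F (cubeExp 1 y) := by intro y; simp [G, co]
  have hgS : ∀ y, S (g (co y)) := fun y => hnear (cubeExp 1 y) _ (by rw [← hGco]; exact hgd _)
  have hgb : ∀ y, cubeExp 1 y ∈ Cube.boundary (Fin i) → g (co y) = x.1 := fun y hy =>
    hgx _ (by rw [hGco, hFb _ hy])
  have hgc : Continuous fun y => g (co y) := hg.continuous.comp hco
  have hpS : ∀ y (t : ℝ), 0 ≤ t → t ≤ 1 → S ((1 - t) • g (co y) + t • p) := fun y t h0 h1 =>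
    (hS _).2 fun a => hp a true (co y) t h0 h1 ((hS _).1 (hgS y) a)
  have hs1 : Continuous fun y : Fin i → I => cubeExp 1 y :=
    cubeExp_continuous.comp (Continuous.prodMk continuous_const continuous_id)
  have hbc := bb_continuous (i := i)
  let L1 := mkLoop x (fun y => F (cubeExp 1 y)) (hF.comp hs1) (fun y => (f.1 _).2)
    (fun y hy => hFb _ (cubeExp_boundary _ _ hy))
  let L2 := mkLoop x (fun y => g (co y)) hgc hgS (fun y hy => hgb y (cubeExp_boundary _ _ hy))
  let L3 := mkLoop x (fun y => (1 - bb y) • g (co y) + bb y • p) (by fun_prop)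
    (fun y => hpS y _ (bb_nonneg y) (bb_le_one y))
    (fun y hy => by rw [bb_boundary y hy, hgb y (cubeExp_boundary _ _ hy)]; simp)
  have H1 : GenLoop.Homotopic f L1 := by
    refine homotopic_of _ _ (fun q => F (cubeExp q.1 q.2)) (hF.comp cubeExp_continuous)
      (fun q => (f.1 _).2) (fun y => ?_) (fun y => rfl) (fun t y hy => hFb _ (cubeExp_boundary _ _ hy))
    rw [cubeExp_zero]
  have H2 : GenLoop.Homotopic L1 L2 := by
    refine homotopic_of _ _ (fun q => (1 - (q.1 : ℝ)) • F (cubeExp 1 q.2) + (q.1 : ℝ) • g (co q.2))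
      ?_ (fun q => ?_) (fun y => ?_) (fun y => ?_) (fun t y hy => ?_)
    · have h1 : Continuous fun q : I × (Fin i → I) => F (cubeExp 1 q.2) :=
        (hF.comp hs1).comp continuous_snd
      fun_prop
    · apply hnear (cubeExp 1 q.2)
      have h1 := hgd (co q.2)
      rw [hGco, dist_eq_norm] at h1
      have h2 : (1 - (q.1 : ℝ)) • F (cubeExp 1 q.2) + (q.1 : ℝ) • g (co q.2) - F (cubeExp 1 q.2)
        = (q.1 : ℝ) • (g (co q.2) - F (cubeExp 1 q.2)) := by module
      rw [dist_eq_norm, h2, norm_smul, Real.norm_of_nonneg q.1.2.1]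
      nlinarith [q.1.2.2, q.1.2.1, norm_nonneg (g (co q.2) - F (cubeExp 1 q.2))]
    · simp [L1, mkLoop]
    · simp [L2, mkLoop]
    · dsimp only
      rw [hgb y (cubeExp_boundary _ _ hy), hFb _ (cubeExp_boundary _ _ hy)]; module
  have H3 : GenLoop.Homotopic L2 L3 := by
    refine homotopic_of _ _
      (fun q => (1 - q.1 * bb q.2) • g (co q.2) + ((q.1 : ℝ) * bb q.2) • p)
      (by fun_prop) (fun q => ?_) (fun y => ?_) (fun y => ?_) (fun t y hy => ?_)
    · exact hpS _ _ (mul_nonneg q.1.2.1 (bb_nonneg _))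
        (mul_le_one₀ q.1.2.2 (bb_nonneg _) (bb_le_one _))
    · simp [L2, mkLoop]
    · simp [L3, mkLoop]
    · dsimp only
      rw [hgb y (cubeExp_boundary _ _ hy), bb_boundary y hy]; simp
  have H4 : GenLoop.Homotopic L3 GenLoop.const := by
    refine homotopic_of _ _
      (fun q => (1 - (1 - q.1) * bb q.2) • x.1 + ((1 - (q.1 : ℝ)) * bb q.2) • p)
      (by fun_prop) (fun q => ?_) (fun y => ?_) (fun y => ?_) (fun t y hy => ?_)
    · exact (hS _).2 fun a => hp a false 0 _ (mul_nonneg (by linarith [q.1.2.2]) (bb_nonneg _))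
        (mul_le_one₀ (by linarith [q.1.2.1]) (bb_nonneg _) (bb_le_one _)) ((hS _).1 x.2 a)
    · simp only [L3, mkLoop]
      rcases bb_or y with h | h
      · simp [h]
      · simp [hgb y h]
    · simp [GenLoop.const]
    · dsimp only
      rw [bb_boundary y hy]; simp
  exact H1.trans (H2.trans (H3.trans H4))

end helpers

section lifting

variable {E F : Type*} [NormedAddCommGroup E] [NormedSpace ℝ E]
  [NormedAddCommGroup F] [NormedSpace ℝ F]

theorem inducedPi_surjective {i : ℕ} {S : E → Prop} {T : F → Prop}
    (f : C({e // S e}, {e // T e})) (A : E →L[ℝ] F) (hf : ∀ x, (f x).1 = A x.1)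
    (s : F → E) (hs : Continuous s) (hTS : ∀ q, T q → S (s q)) (hAs : ∀ q, A (s q) = q)
    (x : {e // S e}) (hj : Joined x ⟨s (f x).1, hTS _ (f x).2⟩) :
    Function.Surjective (inducedPi i f x) := by
  intro cl
  induction cl using Quotient.inductionOn with
  | h w =>
  obtain ⟨γ⟩ := hj
  have hST : ∀ e, S e → T (A e) := fun e he => by
    have := (f ⟨e, he⟩).2
    rwa [hf] at this
  let c : ℝ → E := fun t => (γ.extend t).1
  have hc : Continuous c := continuous_subtype_val.comp γ.continuous_extend
  have hcS : ∀ t, S (c t) := fun t => (γ.extend t).2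
  have hc0 : ∀ t ≤ 0, c t = x.1 := fun t ht => by
    simp only [c]; rw [γ.extend_of_le_zero ht]
  have hc1 : ∀ t, 1 ≤ t → c t = s (f x).1 := fun t ht => by
    simp only [c]; rw [γ.extend_of_one_le ht]
  let W : (Fin i → I) → F := fun y => (w.1 y).1
  have hW : Continuous W := continuous_subtype_val.comp w.1.continuous
  have hWT : ∀ y, T (W y) := fun y => (w.1 y).2
  have hWb : ∀ y ∈ Cube.boundary (Fin i), W y = (f x).1 := fun y hy => by
    show (w.1 y).1 = _
    rw [show w.1 y = f x from w.2 y hy]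
  -- the corrected path
  let d : ℝ → E := fun b => c (2 * b) + s (A (c (2 - 2 * b))) - s (f x).1
  have hd : Continuous d := by fun_prop
  have hdle : ∀ b, b ≤ 1 / 2 → d b = c (2 * b) := fun b hb => by
    simp only [d]
    rw [hc1 (2 - 2 * b) (by linarith), hAs]; abel
  have hdge : ∀ b, 1 / 2 ≤ b → d b = s (A (c (2 - 2 * b))) := fun b hb => by
    simp only [d]
    rw [hc1 (2 * b) (by linarith)]; abel
  have hdS : ∀ b, S (d b) := fun b => by
    rcases le_total b (1 / 2) with h | h
    · rw [hdle b h]; exact hcS _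
    · rw [hdge b h]; exact hTS _ (hST _ (hcS _))
  have hd0 : d 0 = x.1 := by rw [hdle 0 (by norm_num), hc0 _ (by norm_num)]
  have hd1 : d 1 = s (f x).1 := by
    rw [hdge 1 (by norm_num), hc0 _ (by norm_num), hf]
  have hAd : ∀ b, A (d b) = A (c (min (2 * b) (2 - 2 * b))) := fun b => by
    rcases le_total b (1 / 2) with h | h
    · rw [hdle b h, min_eq_left (by linarith)]
    · rw [hdge b h, min_eq_right (by linarith), hAs]
  have hs1 : Continuous fun y : Fin i → I => cubeExp 1 y :=
    cubeExp_continuous.comp (Continuous.prodMk continuous_const continuous_id)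
  have hW1 : Continuous fun y => W (cubeExp 1 y) := hW.comp hs1
  have hbc := bb_continuous (i := i)
  let L := mkLoop x (fun y => d (bb y) + s (W (cubeExp 1 y)) - s (f x).1) (by fun_prop)
    (fun y => by
      rcases bb_or y with h | h
      · rw [h, hd1]
        simpa using hTS _ (hWT _)
      · rw [hWb _ h]; simpa using hdS _)
    (fun y hy => by
      rw [bb_boundary y hy, hd0, hWb _ (cubeExp_boundary _ _ hy)]; simp)
  refine ⟨Quotient.mk _ L, ?_⟩
  refine Quotient.sound ?_
  let M := mkLoop (f x) (fun y => W (cubeExp 1 y)) hW1 (fun y => hWT _)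
    (fun y hy => hWb _ (cubeExp_boundary _ _ hy))
  have H1 : GenLoop.Homotopic w M := by
    refine homotopic_of _ _ (fun q => W (cubeExp q.1 q.2)) (hW.comp cubeExp_continuous)
      (fun q => hWT _) (fun y => ?_) (fun y => rfl)
      (fun t y hy => hWb _ (cubeExp_boundary _ _ hy))
    rw [cubeExp_zero]
  refine GenLoop.Homotopic.trans ?_ H1.symm
  refine homotopic_of _ _ (fun q =>
    A (c ((1 - (q.1 : ℝ)) * min (2 * bb q.2) (2 - 2 * bb q.2))) + W (cubeExp 1 q.2) - (f x).1)
    ?_ (fun q => ?_) (fun y => ?_) (fun y => ?_) (fun t y hy => ?_)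
  · have h1 : Continuous fun q : I × (Fin i → I) => W (cubeExp 1 q.2) := hW1.comp continuous_snd
    fun_prop
  · rcases bb_or q.2 with h | h
    · simp only [h]
      rw [hc0 _ (by norm_num), hf]
      simpa using hWT _
    · simp only [hWb _ h]
      simpa using hST _ (hcS _)
  · have h1 : (f (L.1 y)).1 = A (d (bb y) + s (W (cubeExp 1 y)) - s (f x).1) := hf _
    refine Eq.trans ?_ h1.symm
    rw [map_sub, map_add, hAd, hAs, hAs]
    simp
  · simp only [M, mkLoop]
    rw [hc0 _ (by simp)]
    simp [hf]
  · dsimp only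
    rw [bb_boundary y hy, hWb _ (cubeExp_boundary _ _ hy), hc0 _ (by simp), hf]
    simp

end lifting

section rconf

theorem rconf_trivial (r k n : ℕ) (hr : 2 ≤ r) (hn : 1 ≤ n) (hk : r ≤ k) (i : ℕ)
    (hi : i + 1 < (r - 1) * n) (x : RConf r k n) :
    Subsingleton (HomotopyGroup (Fin i) (RConf r k n) x) := by
  obtain ⟨m, rfl⟩ : ∃ m, r = m + 1 := ⟨r - 1, by omega⟩
  simp only [Nat.add_sub_cancel] at hi
  let Λ : (Fin (m + 1) → Fin k) → ((Fin k → EuclideanSpace ℝ (Fin n)) →ₗ[ℝ]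
      (Fin m → EuclideanSpace ℝ (Fin n))) := fun g =>
    LinearMap.pi fun j =>
      (LinearMap.proj (g j.succ) : (Fin k → EuclideanSpace ℝ (Fin n)) →ₗ[ℝ] _) -
        LinearMap.proj (g 0)
  have hΛ : ∀ g, Function.Injective g → Function.Surjective (Λ g) := by
    intro g hg w
    refine ⟨Function.extend (fun j : Fin m => g j.succ) w 0, ?_⟩
    funext j
    have h1 : Function.Injective fun j : Fin m => g j.succ :=
      hg.comp (Fin.succ_injective m)
    have h2 : Function.extend (fun j : Fin m => g j.succ) w 0 (g j.succ) = w j :=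
      h1.extend_apply w 0 j
    have h3 : Function.extend (fun j : Fin m => g j.succ) w 0 (g 0) = 0 :=
      Function.extend_apply' _ _ _ (by
        rintro ⟨j, hj⟩
        exact Fin.succ_ne_zero j (hg hj))
    simp [Λ, h2, h3]
  let ι := {g : Fin (m + 1) → Fin k // Function.Injective g}
  let V : ι → Submodule ℝ (Fin k → EuclideanSpace ℝ (Fin n)) := fun g => LinearMap.ker (Λ g.1)
  have hE : Module.finrank ℝ (Fin k → EuclideanSpace ℝ (Fin n)) = k * n := by
    rw [Module.finrank_pi_fintype]; simp
  have hV : ∀ a, Module.finrank ℝ (V a) + i + 1 <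
      Module.finrank ℝ (Fin k → EuclideanSpace ℝ (Fin n)) := by
    intro a
    have h1 := LinearMap.finrank_range_add_finrank_ker (Λ a.1)
    rw [LinearMap.range_eq_top.2 (hΛ _ a.2), finrank_top] at h1
    have h2 : Module.finrank ℝ (Fin m → EuclideanSpace ℝ (Fin n)) = m * n := by
      rw [Module.finrank_pi_fintype]; simp
    rw [h2] at h1
    rw [← h1]
    show Module.finrank ℝ (LinearMap.ker (Λ a.1)) + i + 1 < _
    omega
  have key : ∀ f : GenLoop (Fin i) (RConf (m + 1) k n) x,
      GenLoop.Homotopic f GenLoop.const := by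
    refine pi_trivial V hV (by rw [hE]; exact Nat.mul_pos (by omega) (by omega)) _ ?_ x
    intro e
    constructor
    · intro h a ha
      apply h a.1 a.2
      have h1 : ∀ i, e (a.1 i) = e (a.1 0) := by
        intro i
        refine Fin.cases rfl (fun j => ?_) i
        have := congrFun (LinearMap.mem_ker.1 ha) j
        simpa [Λ, sub_eq_zero] using this
      intro i j
      rw [h1 i, h1 j]
    · intro h g hg hc
      apply h ⟨g, hg⟩
      refine LinearMap.mem_ker.2 (funext fun j => ?_)
      simp [Λ, hc j.succ 0]
  refine ⟨fun a b => ?_⟩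
  induction a using Quotient.inductionOn with
  | h a =>
  induction b using Quotient.inductionOn with
  | h b => exact Quotient.sound ((key a).trans (key b).symm)

/-- Add new points far away. -/
def addFar (n k l : ℕ) (e : EuclideanSpace ℝ (Fin n)) (q : Fin k → EuclideanSpace ℝ (Fin n)) :
    Fin l → EuclideanSpace ℝ (Fin n) := fun i =>
  if h : i.1 < k then q ⟨i.1, h⟩ else ((1 + (i.1 : ℝ)) * (1 + ∑ j, ‖q j‖)) • e

theorem addFar_continuous (n k l : ℕ) (e : EuclideanSpace ℝ (Fin n)) :
    Continuous (addFar n k l e) := by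
  refine continuous_pi fun i => ?_
  unfold addFar
  split_ifs <;> fun_prop

theorem addFar_ne (n k l : ℕ) (e : EuclideanSpace ℝ (Fin n)) (he : ‖e‖ = 1)
    (q : Fin k → EuclideanSpace ℝ (Fin n)) (a b : Fin l) (hab : a ≠ b) (ha : k ≤ a.1) :
    addFar n k l e q a ≠ addFar n k l e q b := by
  intro h
  have hM : 0 ≤ ∑ j, ‖q j‖ := Finset.sum_nonneg fun j _ => norm_nonneg _
  have hn := congrArg norm h
  have h1 : ∀ c : Fin l, k ≤ c.1 →
      ‖addFar n k l e q c‖ = (1 + (c.1 : ℝ)) * (1 + ∑ j, ‖q j‖) := by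
    intro c hc
    have h0 : addFar n k l e q c = ((1 + (c.1 : ℝ)) * (1 + ∑ j, ‖q j‖)) • e :=
      dif_neg (not_lt.2 hc)
    have hc' : (0 : ℝ) ≤ c.1 := Nat.cast_nonneg _
    rw [h0, norm_smul, he, mul_one, Real.norm_of_nonneg]
    exact mul_nonneg (by linarith) (by linarith)
  rw [h1 a ha] at hn
  by_cases hb : b.1 < k
  · have h2 : ‖addFar n k l e q b‖ = ‖q ⟨b.1, hb⟩‖ := congrArg norm (dif_pos hb)
    have h3 : ‖q ⟨b.1, hb⟩‖ ≤ ∑ j, ‖q j‖ :=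
      Finset.single_le_sum (f := fun j => ‖q j‖) (fun j _ => norm_nonneg _) (Finset.mem_univ _)
    rw [h2] at hn
    have : (0 : ℝ) ≤ a.1 := Nat.cast_nonneg _
    have h5 : 0 ≤ (a.1 : ℝ) * (1 + ∑ j, ‖q j‖) := mul_nonneg this (by linarith)
    linarith
  · rw [h1 b (not_lt.1 hb)] at hn
    have h4 := mul_right_cancel₀ (ne_of_gt (by linarith)) hn
    exact hab (Fin.ext (by exact_mod_cast (add_left_cancel h4)))

theorem addFar_mem (r n k l : ℕ) (hr : 2 ≤ r) (e : EuclideanSpace ℝ (Fin n)) (he : ‖e‖ = 1)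
    (q : Fin k → EuclideanSpace ℝ (Fin n))
    (hq : ∀ g : Fin r → Fin k, Function.Injective g → ¬ ∀ i j, q (g i) = q (g j)) :
    ∀ g : Fin r → Fin l, Function.Injective g →
      ¬ ∀ i j, addFar n k l e q (g i) = addFar n k l e q (g j) := by
  intro g hg hc
  by_cases h : ∀ i, (g i).1 < k
  · apply hq (fun i => ⟨(g i).1, h i⟩)
    · intro a b hab
      exact hg (Fin.ext (by simpa using hab))
    · intro i j
      have := hc i j
      simpa only [addFar, dif_pos (h i), dif_pos (h j)] using this
  · push Not at h
    obtain ⟨i, hi⟩ := h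
    have : Nontrivial (Fin r) := Fin.nontrivial_iff_two_le.2 hr
    obtain ⟨j, hj⟩ := exists_ne i
    exact addFar_ne n k l e he q (g i) (g j) (fun h => hj (hg h).symm) hi (hc i j)

end rconf

/-- For `r ≤ k < l`, the forgetful map `rConf(l, ℝⁿ) → rConf(k, ℝⁿ)` is
`((r-1)n - 1)`-connected. -/
theorem rConfForget_connected (r n : ℕ) {k l : ℕ} (hrk : r ≤ k) (hkl : k < l) :
    IsConnectedMap (((r : ℤ) - 1) * n - 1) (rConfForget r n hkl.le) := by
  by_cases hc0 : (((r : ℤ) - 1) * n - 1) < 0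
  · refine ⟨fun h => absurd h (not_le.2 hc0), fun x i hi => ?_, fun x i hi => ?_⟩ <;>
      exfalso <;> omega
  have hn : 1 ≤ n := by
    by_contra h
    have : n = 0 := by omega
    subst this
    simp at hc0
  have hr : 2 ≤ r := by
    by_contra h
    have h1 : (r : ℤ) - 1 ≤ 0 := by omega
    have h2 : (0 : ℤ) ≤ n := by omega
    have := mul_nonpos_of_nonpos_of_nonneg h1 h2
    omega
  have hcast : (((r - 1) * n : ℕ) : ℤ) = ((r : ℤ) - 1) * n := by
    push_cast [Nat.cast_sub (show 1 ≤ r by omega)]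
    ring
  rw [← hcast] at hc0 ⊢
  let e : EuclideanSpace ℝ (Fin n) := EuclideanSpace.single ⟨0, hn⟩ 1
  have he : ‖e‖ = 1 := by simp [e]
  refine ⟨fun _ ⟨q⟩ => ⟨⟨addFar n k l e q.1, addFar_mem r n k l hr e he q.1 q.2⟩⟩,
    fun x i hi => ?_, fun x i hi => ?_⟩
  · have h1 := rconf_trivial r l n hr hn (by omega) i (by omega) x
    have h2 := rconf_trivial r k n hr hn (by omega) i (by omega) (rConfForget r n hkl.le x)
    exact ⟨fun a b _ => Subsingleton.elim _ _, fun b => ⟨default, Subsingleton.elim _ _⟩⟩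
  · have hA : ∀ q, (fun i => addFar n k l e q (Fin.castLE hkl.le i)) = q := by
      intro q
      funext i
      simp [addFar]
    by_cases hi0 : i = 0
    · subst hi0
      intro cl
      induction cl using Quotient.inductionOn with
      | h w =>
      have hb : ∀ y ∈ Cube.boundary (Fin 0), False := fun y ⟨j, _⟩ => j.elim0
      refine ⟨Quotient.mk _ ⟨⟨fun y => ⟨addFar n k l e (w.1 y).1,
        addFar_mem r n k l hr e he _ (w.1 y).2⟩, ?_⟩, fun y hy => (hb y hy).elim⟩, ?_⟩
      · exact Continuous.subtype_mk ((addFar_continuous n k l e).comp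
          (continuous_subtype_val.comp w.1.continuous)) _
      · refine congrArg (Quotient.mk _) ?_
        refine Subtype.ext (ContinuousMap.ext fun y => Subtype.ext ?_)
        exact hA (w.1 y).1
    · have hsub := rconf_trivial r l n hr hn (by omega) 0 (by omega) x
      have hj : ∀ z : RConf r l n, Joined x z := by
        intro z
        let φ := HomotopyGroup.pi0EquivZerothHomotopy (X := RConf r l n) (x := x)
        have hφ : φ.symm (Quotient.mk _ x) = φ.symm (Quotient.mk _ z) := hsub.elim _ _
        exact Quotient.exact (φ.symm.injective hφ)
      exact inducedPi_surjective (rConfForget r n hkl.le)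
        (ContinuousLinearMap.pi fun i => ContinuousLinearMap.proj (Fin.castLE hkl.le i))
        (fun x => rfl) (addFar n k l e) (addFar_continuous n k l e)
        (fun q hq => addFar_mem r n k l hr e he q hq) hA x (hj _)
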